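/- Let 0 < p < 1, and set α = p³(2+p)/(1+2p) and β = (27/4)·p²(1+p)²/(1+p+p²)³. Then (1 + p + p²)·F(1/2, 1/2; 1; 1−α) = √(3+6p)·F(1/3, 2/3; 1; 1−β). -/

import Mathlib

/-- The Gauss hypergeometric series `F(a, b; c; x) = ∑ (a)_n (b)_n / ((c)_n n!) xⁿ`,
where `(q)_n` is the rising Pochhammer symbol. -/
noncomputable def hypF (a b c x : ℝ) : ℝ :=
  ∑' n : ℕ, ((ascPochhammer ℝ n).eval a * (ascPochhammer ℝ n).eval b /
    ((ascPochhammer ℝ n).eval c * (Nat.factorial n))) * x ^ n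

/-- Termwise differentiation of a real power series with coefficients bounded by `1`. -/
theorem hasDerivAt_tsum_mul_pow {c : ℕ → ℝ} (hc : ∀ n, |c n| ≤ 1) {x : ℝ} (hx : |x| < 1) :
    HasDerivAt (fun y : ℝ => ∑' n, c n * y ^ n) (∑' n, c n * (n * x ^ (n - 1))) x := by
  obtain ⟨r, hxr, hr1⟩ := exists_between hx
  have hr0 : 0 < r := (abs_nonneg x).trans_lt hxr
  have hsum : Summable fun n : ℕ => (n : ℝ) * r ^ (n - 1) := by
    have h := (summable_pow_mul_geometric_of_norm_lt_one 1
      (by rwa [Real.norm_eq_abs, abs_of_pos hr0] : ‖r‖ < 1)).mul_left r⁻¹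
    refine h.congr fun n => ?_
    cases n with
    | zero => simp
    | succ k => simp only [Nat.add_sub_cancel, pow_succ]; field_simp
  refine hasDerivAt_tsum_of_isPreconnected (t := Set.Ioo (-r) r) (y₀ := 0) hsum isOpen_Ioo
    isPreconnected_Ioo (fun n y _ => (hasDerivAt_pow n y).const_mul (c n)) ?_ ?_ ?_
    (abs_lt.mp hxr)
  · intro n y hy
    rw [Real.norm_eq_abs, abs_mul, abs_mul, abs_pow, Nat.abs_cast]
    have hy' : |y| ≤ r := (abs_lt.mpr hy).le
    calc |c n| * (n * |y| ^ (n - 1)) ≤ 1 * (n * r ^ (n - 1)) := by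
          gcongr
          exact hc n
      _ = n * r ^ (n - 1) := one_mul _
  · exact ⟨by linarith, hr0⟩
  · refine summable_of_ne_finset_zero (s := {0}) fun n hn => ?_
    simp only [Finset.mem_singleton] at hn
    simp [hn]

theorem summable_mul_natCast_mul_pow {c : ℕ → ℝ} (hc : ∀ n, |c n| ≤ 1) {x : ℝ} (hx : |x| < 1) :
    Summable fun n : ℕ => c n * (n * x ^ n) := by
  have h := summable_pow_mul_geometric_of_norm_lt_one 1
      (by rwa [Real.norm_eq_abs, abs_abs] : ‖|x|‖ < 1)
  refine Summable.of_norm_bounded h fun n => ?_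
  rw [Real.norm_eq_abs, abs_mul, abs_mul, abs_pow, Nat.abs_cast, pow_one]
  exact mul_le_of_le_one_left (by positivity) (hc n)

/-- The coefficients of `F(a, b; 1; x)`. -/
noncomputable def hypCoeff (a b : ℝ) (n : ℕ) : ℝ :=
  (ascPochhammer ℝ n).eval a * (ascPochhammer ℝ n).eval b /
    ((ascPochhammer ℝ n).eval 1 * (Nat.factorial n))

theorem ascPochhammer_eval_nonneg {a : ℝ} (ha : 0 ≤ a) (n : ℕ) :
    0 ≤ (ascPochhammer ℝ n).eval a := by
  induction n with
  | zero => simp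
  | succ k ih => rw [ascPochhammer_succ_eval]; positivity

theorem ascPochhammer_eval_le_factorial {a : ℝ} (ha : 0 ≤ a) (ha1 : a ≤ 1) (n : ℕ) :
    (ascPochhammer ℝ n).eval a ≤ n.factorial := by
  induction n with
  | zero => simp
  | succ k ih =>
    rw [ascPochhammer_succ_eval, Nat.factorial_succ, Nat.cast_mul, mul_comm,
      Nat.cast_add_one]
    exact mul_le_mul (by linarith) ih (ascPochhammer_eval_nonneg ha k) (by positivity)

theorem hypCoeff_zero (a b : ℝ) : hypCoeff a b 0 = 1 := by simp [hypCoeff]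

theorem hypCoeff_succ (a b : ℝ) (n : ℕ) :
    (n + 1) ^ 2 * hypCoeff a b (n + 1) = (a + n) * (b + n) * hypCoeff a b n := by
  have h : (n.factorial : ℝ) ≠ 0 := by positivity
  have h' : (n : ℝ) + 1 ≠ 0 := by positivity
  simp only [hypCoeff, ascPochhammer_succ_eval, ascPochhammer_eval_one, Nat.factorial_succ,
    Nat.cast_mul, Nat.cast_add, Nat.cast_one]
  field_simp
  ring

theorem hypCoeff_nonneg {a b : ℝ} (ha : 0 ≤ a) (hb : 0 ≤ b) (n : ℕ) : 0 ≤ hypCoeff a b n := by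
  have := ascPochhammer_eval_nonneg ha n
  have := ascPochhammer_eval_nonneg hb n
  have := ascPochhammer_eval_nonneg zero_le_one n
  unfold hypCoeff
  positivity

theorem abs_hypCoeff_le_one {a b : ℝ} (ha : 0 ≤ a) (ha1 : a ≤ 1) (hb : 0 ≤ b) (hb1 : b ≤ 1)
    (n : ℕ) : |hypCoeff a b n| ≤ 1 := by
  rw [abs_of_nonneg (hypCoeff_nonneg ha hb n), hypCoeff, ascPochhammer_eval_one]
  refine div_le_one_of_le₀ ?_ (by positivity)
  exact mul_le_mul (ascPochhammer_eval_le_factorial ha ha1 n)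
    (ascPochhammer_eval_le_factorial hb hb1 n) (ascPochhammer_eval_nonneg hb n) (by positivity)

theorem hypF_eq_tsum (a b x : ℝ) : hypF a b 1 x = ∑' n, hypCoeff a b n * x ^ n := rfl

theorem hypF_zero (a b : ℝ) : hypF a b 1 0 = 1 := by
  rw [hypF_eq_tsum, tsum_eq_single 0 (fun n hn => by simp [hn])]
  simp [hypCoeff_zero]

theorem hypF_pos {a b x : ℝ} (ha : 0 ≤ a) (ha1 : a ≤ 1) (hb : 0 ≤ b) (hb1 : b ≤ 1)
    (hx : 0 ≤ x) (hx1 : x < 1) : 0 < hypF a b 1 x := by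
  have hs : Summable fun n => hypCoeff a b n * x ^ n := by
    refine Summable.of_norm_bounded (summable_geometric_of_lt_one hx hx1) fun n => ?_
    rw [Real.norm_eq_abs, abs_mul, abs_of_nonneg (pow_nonneg hx n)]
    exact mul_le_of_le_one_left (by positivity) (abs_hypCoeff_le_one ha ha1 hb hb1 n)
  refine hs.tsum_pos (fun n => mul_nonneg (hypCoeff_nonneg ha hb n) (pow_nonneg hx n)) 0 ?_
  simp [hypCoeff_zero]

/-- The derivative of `F(a, b; 1; x)`, as a power series. -/
noncomputable def hypFDeriv (a b x : ℝ) : ℝ := ∑' n : ℕ, hypCoeff a b n * (n * x ^ (n - 1))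

theorem hasDerivAt_hypF {a b x : ℝ} (ha : 0 ≤ a) (ha1 : a ≤ 1) (hb : 0 ≤ b) (hb1 : b ≤ 1)
    (hx : |x| < 1) : HasDerivAt (hypF a b 1) (hypFDeriv a b x) x :=
  hasDerivAt_tsum_mul_pow (abs_hypCoeff_le_one ha ha1 hb hb1) hx

/-- The coefficients of `x (1 - x) F'(x)` for `F(x) = F(a, b; 1; x)` with `a + b = 1`. -/
noncomputable def hypFluxCoeff (a b : ℝ) : ℕ → ℝ
  | 0 => 0
  | n + 1 => a * b * hypCoeff a b n / (n + 1)

theorem abs_hypFluxCoeff_le_one {a b : ℝ} (ha : 0 ≤ a) (ha1 : a ≤ 1) (hb : 0 ≤ b) (hb1 : b ≤ 1)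
    (n : ℕ) : |hypFluxCoeff a b n| ≤ 1 := by
  cases n with
  | zero => simp [hypFluxCoeff]
  | succ k =>
    have h0 := hypCoeff_nonneg ha hb k
    have h1 := abs_hypCoeff_le_one ha ha1 hb hb1 k
    rw [abs_of_nonneg h0] at h1
    rw [hypFluxCoeff, abs_of_nonneg (by positivity)]
    refine div_le_one_of_le₀ ?_ (by positivity)
    have : a * b * hypCoeff a b k ≤ 1 := mul_le_one₀ (mul_le_one₀ ha1 hb hb1) h0 h1
    have : (0 : ℝ) ≤ k := k.cast_nonneg
    linarith

theorem tsum_hypFluxCoeff {a b x : ℝ} (ha : 0 ≤ a) (ha1 : a ≤ 1) (hb : 0 ≤ b) (hb1 : b ≤ 1)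
    (hab : a + b = 1) (hx : |x| < 1) :
    ∑' n, hypFluxCoeff a b n * x ^ n = x * (1 - x) * hypFDeriv a b x := by
  have hs := summable_mul_natCast_mul_pow (abs_hypCoeff_le_one ha ha1 hb hb1) hx
  have hxD : x * hypFDeriv a b x = ∑' n : ℕ, hypCoeff a b n * (n * x ^ n) := by
    rw [hypFDeriv, ← tsum_mul_left]
    refine tsum_congr fun n => ?_
    cases n with
    | zero => simp
    | succ k => simp only [Nat.add_sub_cancel, pow_succ]; ring
  have hshift : ∑' n : ℕ, hypCoeff a b n * (n * x ^ n) =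
      ∑' n : ℕ, hypCoeff a b (n + 1) * ((n + 1 : ℕ) * x ^ (n + 1)) := by
    rw [hs.tsum_eq_zero_add]; simp
  have hflux : Summable fun n : ℕ => hypFluxCoeff a b n * x ^ n := by
    refine Summable.of_norm_bounded (summable_geometric_of_lt_one (abs_nonneg x) hx) fun n => ?_
    rw [Real.norm_eq_abs, abs_mul, abs_pow]
    exact mul_le_of_le_one_left (by positivity) (abs_hypFluxCoeff_le_one ha ha1 hb hb1 n)
  calc ∑' n, hypFluxCoeff a b n * x ^ n
      = ∑' n, hypFluxCoeff a b (n + 1) * x ^ (n + 1) := by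
        rw [hflux.tsum_eq_zero_add]; simp [hypFluxCoeff]
    _ = ∑' n : ℕ, (hypCoeff a b (n + 1) * ((n + 1 : ℕ) * x ^ (n + 1)) -
          x * (hypCoeff a b n * (n * x ^ n))) := by
        refine tsum_congr fun n => ?_
        have h' : (n : ℝ) + 1 ≠ 0 := by positivity
        have hrec := hypCoeff_succ a b n
        obtain rfl : b = 1 - a := by linarith
        rw [hypFluxCoeff]
        push_cast
        field_simp
        linear_combination -(x * x ^ n) * hrec
    _ = x * (1 - x) * hypFDeriv a b x := by
        rw [((summable_nat_add_iff 1).mpr hs).tsum_sub (hs.mul_left x), ← hshift, tsum_mul_left,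
          ← hxD]
        ring

/-- The self-adjoint form `(x (1 - x) F')' = a b F` of the hypergeometric equation for
`F(a, b; 1; x)` with `a + b = 1`. -/
theorem hasDerivAt_mul_hypFDeriv {a b x : ℝ} (ha : 0 ≤ a) (ha1 : a ≤ 1) (hb : 0 ≤ b)
    (hb1 : b ≤ 1) (hab : a + b = 1) (hx : |x| < 1) :
    HasDerivAt (fun y => y * (1 - y) * hypFDeriv a b y) (a * b * hypF a b 1 x) x := by
  have h := hasDerivAt_tsum_mul_pow (abs_hypFluxCoeff_le_one ha ha1 hb hb1) hx
  have hval : ∑' n : ℕ, hypFluxCoeff a b n * (n * x ^ (n - 1)) = a * b * hypF a b 1 x := by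
    have hsupp : Function.support (fun n : ℕ => hypFluxCoeff a b n * (n * x ^ (n - 1))) ⊆
        Set.range Nat.succ := by
      intro n hn
      cases n with
      | zero => simp [hypFluxCoeff] at hn
      | succ k => exact ⟨k, rfl⟩
    rw [hypF_eq_tsum, ← tsum_mul_left, ← Nat.succ_injective.tsum_eq hsupp]
    refine tsum_congr fun n => ?_
    have h' : (n : ℝ) + 1 ≠ 0 := by positivity
    simp only [hypFluxCoeff, Nat.succ_eq_add_one, Nat.add_sub_cancel]
    push_cast
    field_simp
  rw [hval] at h
  refine h.congr_of_eventuallyEq ?_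
  have hnhds : {y : ℝ | |y| < 1} ∈ nhds x := (isOpen_lt continuous_abs continuous_const).mem_nhds hx
  filter_upwards [hnhds] with y hy
  exact (tsum_hypFluxCoeff ha ha1 hb hb1 hab hy).symm

/-- Two functions with `P u' = A`, `A' = Q u`, `P v' = B`, `B' = Q v` where `P ≠ 0` on `[p, q)`,
`P q = 0` and `u ≠ 0`, are proportional on `[p, q]`. -/
theorem mul_eq_mul_of_sturm_liouville {p q : ℝ} (hpq : p ≤ q) {u v u' v' A B P Q : ℝ → ℝ}
    (hu : ∀ t ∈ Set.Icc p q, HasDerivAt u (u' t) t)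
    (hv : ∀ t ∈ Set.Icc p q, HasDerivAt v (v' t) t)
    (hA : ∀ t ∈ Set.Icc p q, HasDerivAt A (Q t * u t) t)
    (hB : ∀ t ∈ Set.Icc p q, HasDerivAt B (Q t * v t) t)
    (hAu : ∀ t ∈ Set.Icc p q, A t = P t * u' t)
    (hBv : ∀ t ∈ Set.Icc p q, B t = P t * v' t)
    (hP : ∀ t ∈ Set.Ico p q, P t ≠ 0) (hPq : P q = 0)
    (hu0 : ∀ t ∈ Set.Icc p q, u t ≠ 0) :
    v p * u q = v q * u p := by
  have hWderiv : ∀ t ∈ Set.Icc p q, HasDerivAt (fun s => A s * v s - B s * u s) 0 t := by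
    intro t ht
    refine (((hA t ht).mul (hv t ht)).sub ((hB t ht).mul (hu t ht))).congr_deriv ?_
    rw [hAu t ht, hBv t ht]
    ring
  have hW : ∀ t ∈ Set.Icc p q, A t * v t - B t * u t = 0 := by
    have hconst := constant_of_has_deriv_right_zero
      (f := fun s => A s * v s - B s * u s) (a := p) (b := q)
      (fun t ht => (hWderiv t ht).continuousAt.continuousWithinAt)
      (fun t ht => (hWderiv t (Set.Ico_subset_Icc_self ht)).hasDerivWithinAt)
    have hq : q ∈ Set.Icc p q := ⟨hpq, le_rfl⟩
    intro t ht
    have h1 := hconst t ht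
    have h2 := hconst q hq
    simp only [hAu q hq, hBv q hq, hPq] at h1 h2
    linarith
  have hquot : ∀ t ∈ Set.Ico p q, HasDerivAt (fun s => v s / u s) 0 t := by
    intro t ht
    have ht' := Set.Ico_subset_Icc_self ht
    refine ((hv t ht').div (hu t ht') (hu0 t ht')).congr_deriv ?_
    have h := hW t ht'
    rw [hAu t ht', hBv t ht'] at h
    rw [div_eq_zero_iff]
    left
    refine mul_left_cancel₀ (hP t ht) ?_
    linear_combination -h
  have h := constant_of_has_deriv_right_zero
      (f := fun s => v s / u s) (a := p) (b := q)
      (fun t ht => ((hv t ht).continuousAt.div (hu t ht).continuousAt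
        (hu0 t ht)).continuousWithinAt)
      (fun t ht => (hquot t ht).hasDerivWithinAt) q ⟨hpq, le_rfl⟩
  have hup := hu0 p ⟨le_rfl, hpq⟩
  have huq := hu0 q ⟨hpq, le_rfl⟩
  field_simp at h
  linear_combination -h

theorem hasDerivAt_one_sub_elliptic {t : ℝ} (ht : 0 < t) :
    HasDerivAt (fun s : ℝ => 1 - s ^ 3 * (2 + s) / (1 + 2 * s))
      (-(6 * t ^ 2 * (1 + t) ^ 2 / (1 + 2 * t) ^ 2)) t := by
  have hs : 1 + 2 * t ≠ 0 := by positivity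
  have h1 := ((hasDerivAt_pow 3 t).mul ((hasDerivAt_id t).const_add 2)).div
    (((hasDerivAt_id t).const_mul 2).const_add 1) hs
  refine (h1.const_sub 1).congr_deriv ?_
  simp only [id, Pi.mul_apply]
  field_simp
  ring

theorem hasDerivAt_one_sub_cubic {t : ℝ} (ht : 0 < t) :
    HasDerivAt (fun s : ℝ => 1 - (27 / 4) * (s ^ 2 * (1 + s) ^ 2 / (1 + s + s ^ 2) ^ 3))
      (-(27 / 4 * (t * (1 + t) * (1 + 2 * t) * (1 - t) * (2 + t)) / (1 + t + t ^ 2) ^ 4)) t := by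
  have hk : (1 + t + t ^ 2) ^ 3 ≠ 0 := by positivity
  have hk' : 1 + t + t ^ 2 ≠ 0 := by positivity
  have h1 := ((hasDerivAt_pow 2 t).mul (((hasDerivAt_id t).const_add 1).pow 2)).div
    ((((hasDerivAt_id t).const_add 1).add (hasDerivAt_pow 2 t)).pow 3) hk
  refine ((h1.const_mul (27 / 4)).const_sub 1).congr_deriv ?_
  simp only [id, Pi.mul_apply, Pi.add_apply, Pi.pow_apply]
  field_simp
  ring

theorem one_sub_elliptic_mem {t : ℝ} (ht : 0 < t) (ht1 : t ≤ 1) :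
    0 ≤ 1 - t ^ 3 * (2 + t) / (1 + 2 * t) ∧ 1 - t ^ 3 * (2 + t) / (1 + 2 * t) < 1 := by
  have h : 1 - t ^ 3 * (2 + t) / (1 + 2 * t) = (1 - t) * (1 + t) ^ 3 / (1 + 2 * t) := by
    field_simp
    ring
  refine ⟨?_, ?_⟩
  · rw [h]
    have : 0 ≤ 1 - t := by linarith
    positivity
  · have : 0 < t ^ 3 * (2 + t) / (1 + 2 * t) := by positivity
    linarith

theorem one_sub_cubic_mem {t : ℝ} (ht : 0 < t) :
    0 ≤ 1 - (27 / 4) * (t ^ 2 * (1 + t) ^ 2 / (1 + t + t ^ 2) ^ 3) ∧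
      1 - (27 / 4) * (t ^ 2 * (1 + t) ^ 2 / (1 + t + t ^ 2) ^ 3) < 1 := by
  have h : 1 - (27 / 4) * (t ^ 2 * (1 + t) ^ 2 / (1 + t + t ^ 2) ^ 3) =
      (1 - t) ^ 2 * (1 + 2 * t) ^ 2 * (2 + t) ^ 2 / (4 * (1 + t + t ^ 2) ^ 3) := by
    field_simp
    ring
  refine ⟨?_, ?_⟩
  · rw [h]
    positivity
  · have : 0 < (27 / 4) * (t ^ 2 * (1 + t) ^ 2 / (1 + t + t ^ 2) ^ 3) := by positivity
    linarith

theorem hasDerivAt_inv_sqrt_one_add_two_mul {t : ℝ} (ht : 0 < t) :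
    HasDerivAt (fun s : ℝ => (√(1 + 2 * s))⁻¹) (-((√(1 + 2 * t))⁻¹ / (1 + 2 * t))) t := by
  have hs : 0 < 1 + 2 * t := by positivity
  have hσ : √(1 + 2 * t) ≠ 0 := by positivity
  have h := ((((hasDerivAt_id t).const_mul 2).const_add 1).sqrt hs.ne').inv hσ
  refine h.congr_deriv ?_
  simp only [id]
  rw [Real.sq_sqrt hs.le]
  field_simp

theorem bbg_corollary_5_7 (p : ℝ) (hp0 : 0 < p) (hp1 : p < 1) :
    (1 + p + p ^ 2) * hypF (1/2) (1/2) 1 (1 - p ^ 3 * (2 + p) / (1 + 2 * p)) =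
      Real.sqrt (3 + 6 * p) *
        hypF (1/3) (2/3) 1 (1 - (27/4) * (p ^ 2 * (1 + p) ^ 2 / (1 + p + p ^ 2) ^ 3)) := by
  set X : ℝ → ℝ := fun t => 1 - t ^ 3 * (2 + t) / (1 + 2 * t) with hX
  set Z : ℝ → ℝ := fun t => 1 - (27/4) * (t ^ 2 * (1 + t) ^ 2 / (1 + t + t ^ 2) ^ 3) with hZ
  set ρ : ℝ → ℝ := fun t => (√(1 + 2 * t))⁻¹ with hρ
  set f : ℝ → ℝ := fun t => hypF (1/2) (1/2) 1 (X t) with hf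
  set f' : ℝ → ℝ := fun t => hypFDeriv (1/2) (1/2) (X t) with hf'
  set w : ℝ → ℝ := fun t => X t * (1 - X t) * f' t with hw
  set g : ℝ → ℝ := fun t => hypF (1/3) (2/3) 1 (Z t) with hg
  set g' : ℝ → ℝ := fun t => hypFDeriv (1/3) (2/3) (Z t) with hg'
  set X' : ℝ → ℝ := fun t => -(6 * t ^ 2 * (1 + t) ^ 2 / (1 + 2 * t) ^ 2) with hX'
  set Z' : ℝ → ℝ := fun t =>
    -(27 / 4 * (t * (1 + t) * (1 + 2 * t) * (1 - t) * (2 + t)) / (1 + t + t ^ 2) ^ 4) with hZ'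
  have hpos : ∀ t ∈ Set.Icc p 1, 0 < t := fun t ht => hp0.trans_le ht.1
  have habsX : ∀ t ∈ Set.Icc p 1, |X t| < 1 := fun t ht => by
    obtain ⟨h0, h1⟩ := one_sub_elliptic_mem (hpos t ht) ht.2
    exact abs_lt.mpr ⟨neg_one_lt_zero.trans_le h0, h1⟩
  have habsZ : ∀ t ∈ Set.Icc p 1, |Z t| < 1 := fun t ht => by
    obtain ⟨h0, h1⟩ := one_sub_cubic_mem (hpos t ht)
    exact abs_lt.mpr ⟨neg_one_lt_zero.trans_le h0, h1⟩
  have hXd : ∀ t ∈ Set.Icc p 1, HasDerivAt X (X' t) t := fun t ht =>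
    hasDerivAt_one_sub_elliptic (hpos t ht)
  have hZd : ∀ t ∈ Set.Icc p 1, HasDerivAt Z (Z' t) t := fun t ht =>
    hasDerivAt_one_sub_cubic (hpos t ht)
  have hρd : ∀ t ∈ Set.Icc p 1, HasDerivAt ρ (-(ρ t / (1 + 2 * t))) t := fun t ht =>
    hasDerivAt_inv_sqrt_one_add_two_mul (hpos t ht)
  have hfd : ∀ t ∈ Set.Icc p 1, HasDerivAt f (f' t * X' t) t := fun t ht =>
    (hasDerivAt_hypF (by norm_num) (by norm_num) (by norm_num) (by norm_num)
      (habsX t ht)).comp t (hXd t ht)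
  have hgd : ∀ t ∈ Set.Icc p 1, HasDerivAt g (g' t * Z' t) t := fun t ht =>
    (hasDerivAt_hypF (by norm_num) (by norm_num) (by norm_num) (by norm_num)
      (habsZ t ht)).comp t (hZd t ht)
  have hwd : ∀ t ∈ Set.Icc p 1, HasDerivAt w (1 / 2 * (1 / 2) * f t * X' t) t := fun t ht =>
    (hasDerivAt_mul_hypFDeriv (by norm_num) (by norm_num) (by norm_num) (by norm_num)
      (by norm_num) (habsX t ht)).comp t (hXd t ht)
  have hvd : ∀ t ∈ Set.Icc p 1, HasDerivAt (fun s => Z s * (1 - Z s) * g' s)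
      (1 / 3 * (2 / 3) * g t * Z' t) t := fun t ht =>
    (hasDerivAt_mul_hypFDeriv (by norm_num) (by norm_num) (by norm_num) (by norm_num)
      (by norm_num) (habsZ t ht)).comp t (hZd t ht)
  have hkd : ∀ t : ℝ, HasDerivAt (fun s : ℝ => 1 + s + s ^ 2) (1 + 2 * t) t := fun t =>
    (((hasDerivAt_id t).const_add 1).add (hasDerivAt_pow 2 t)).congr_deriv (by simp)
  have hmain := mul_eq_mul_of_sturm_liouville hp1.le
    (u := fun t => (1 + t + t ^ 2) * ρ t * f t) (v := g)
    (u' := fun t => (1 + 2 * t - (1 + t + t ^ 2) / (1 + 2 * t)) * ρ t * f t +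
      (1 + t + t ^ 2) * ρ t * (f' t * X' t))
    (v' := fun t => g' t * Z' t)
    (A := fun t => ρ t * (3 * t ^ 2 * (1 + t) ^ 2 * (1 - t) * (2 + t) / (1 + t + t ^ 2) ^ 2 * f t -
      6 * (1 + 2 * t) / (1 + t + t ^ 2) * w t))
    (B := fun t => -4 * (Z t * (1 - Z t) * g' t))
    (P := fun t => t * (1 - t) * (1 + t) * (2 + t) * (1 + 2 * t) / (1 + t + t ^ 2) ^ 2)
    (Q := fun t => 6 * (t * (1 + t) * (1 + 2 * t) * (1 - t) * (2 + t)) / (1 + t + t ^ 2) ^ 4)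
    ?_ hgd ?_ ?_ ?_ ?_ ?_ (by norm_num) ?_
  · have hX1 : X 1 = 0 := by norm_num [hX]
    have hZ1 : Z 1 = 0 := by norm_num [hZ]
    have h3 : √3 * √3 = (3 : ℝ) := Real.mul_self_sqrt (by norm_num)
    have hsqrt : √(3 + 6 * p) = √3 * √(1 + 2 * p) := by
      rw [← Real.sqrt_mul (by norm_num)]
      congr 1
      ring
    have hσ : √(1 + 2 * p) ≠ 0 := by positivity
    have h3' : √(1 + 2 * 1) = √(3 : ℝ) := by norm_num
    simp only [hf, hg, hX1, hZ1, hypF_zero, hρ, h3'] at hmain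
    change (1 + p + p ^ 2) * f p = √(3 + 6 * p) * g p
    rw [hsqrt]
    simp only [hf, hg]
    field_simp at hmain
    linear_combination -√3 / 3 * hmain -
      (1 + p + p ^ 2) * hypF (1/2) (1/2) 1 (X p) / 3 * h3
  · intro t ht
    have := hpos t ht
    refine (((hkd t).mul (hρd t ht)).mul (hfd t ht)).congr_deriv ?_
    simp only [Pi.mul_apply]
    field_simp
    ring
  · intro t ht
    have := hpos t ht
    have hk : 1 + t + t ^ 2 ≠ 0 := by positivity
    have hk2 : (1 + t + t ^ 2) ^ 2 ≠ 0 := by positivity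
    have hnum : HasDerivAt (fun t : ℝ => 3 * t ^ 2 * (1 + t) ^ 2 * (1 - t) * (2 + t))
        (3 * t * (1 + t) * (1 + 2 * t) * (4 - 3 * t - 3 * t ^ 2)) t := by
      have h := ((((hasDerivAt_pow 2 t).const_mul 3).mul
        (((hasDerivAt_id t).const_add 1).pow 2)).mul ((hasDerivAt_id t).const_sub 1)).mul
        ((hasDerivAt_id t).const_add 2)
      refine h.congr_deriv ?_
      simp only [id, Pi.mul_apply, Pi.pow_apply]
      ring
    have h6 : HasDerivAt (fun t : ℝ => 6 * (1 + 2 * t)) 12 t :=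
      ((((hasDerivAt_id t).const_mul 2).const_add 1).const_mul 6).congr_deriv (by norm_num)
    refine ((hρd t ht).mul (((hnum.div ((hkd t).pow 2) hk2).mul (hfd t ht)).sub
      ((h6.div (hkd t) hk).mul (hwd t ht)))).congr_deriv ?_
    simp only [Pi.mul_apply, Pi.div_apply, Pi.sub_apply, Pi.pow_apply, hw, hX, hX']
    field_simp
    ring
  · intro t ht
    refine ((hvd t ht).const_mul (-4)).congr_deriv ?_
    simp only [hZ']
    ring
  · intro t ht
    have := hpos t ht
    simp only [hw, hX, hX']
    field_simp
    ring
  · intro t ht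
    have := hpos t ht
    simp only [hZ, hZ']
    field_simp
    ring
  · intro t ht
    have := hpos t (Set.Ico_subset_Icc_self ht)
    have : 0 < 1 - t := sub_pos.mpr ht.2
    positivity
  · intro t ht
    have := hpos t ht
    obtain ⟨h0, h1⟩ := one_sub_elliptic_mem (hpos t ht) ht.2
    have hfpos : 0 < f t :=
      hypF_pos (by norm_num) (by norm_num) (by norm_num) (by norm_num) h0 h1
    have hρpos : 0 < ρ t := by simp only [hρ]; positivity
    positivity
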